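/- arXiv:2005.00671 — 4 statements merged into one kernel-verified Lean document; each statement's English description precedes it below -/
import Mathlib

section
/- Let G be a finite simple graph with μ(G) < ν(G), and let (M, H, H') be a maximum intersection triple in G. Then G contains no cycle whose edges alternate between M ∖ H and H ∖ M; in particular, no maximal M,H-alternating path closes into a cycle. -/
open Finset

section Defs
variable {V : Type*}

/-- A matching: a set of edges, pairwise non-adjacent. -/
def IsMatchingSet (G : SimpleGraph V) (M : Finset (Sym2 V)) : Prop :=
  ↑M ⊆ G.edgeSet ∧ ∀ e ∈ M, ∀ f ∈ M, e ≠ f → ∀ v : V, v ∈ e → v ∉ f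

/-- A vertex is saturated by a matching if some edge of it is incident to the vertex. -/
def Saturates (M : Finset (Sym2 V)) (v : V) : Prop :=
  ∃ e ∈ M, v ∈ e

/-- ν(G): maximum size of a matching. -/
noncomputable def nuG (G : SimpleGraph V) : ℕ :=
  sSup {n | ∃ M : Finset (Sym2 V), IsMatchingSet G M ∧ M.card = n}

/-- λ(G): maximum of |H| + |H'| over pairs of disjoint matchings. -/
noncomputable def lamG (G : SimpleGraph V) : ℕ :=
  sSup {n | ∃ H H' : Finset (Sym2 V), IsMatchingSet G H ∧ IsMatchingSet G H' ∧
    Disjoint H H' ∧ H.card + H'.card = n}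

/-- Λ(G): set of pairs of disjoint matchings realizing λ(G). -/
def LambdaSet (G : SimpleGraph V) : Set (Finset (Sym2 V) × Finset (Sym2 V)) :=
  {p | IsMatchingSet G p.1 ∧ IsMatchingSet G p.2 ∧ Disjoint p.1 p.2 ∧
    p.1.card + p.2.card = lamG G}

/-- μ(G): maximum of |H| over pairs (H, H') ∈ Λ(G). -/
noncomputable def muG (G : SimpleGraph V) : ℕ :=
  sSup {n | ∃ p ∈ LambdaSet G, p.1.card = n}

/-- Λ_μ(G): pairs in Λ(G) with |H| = μ(G). -/
def LambdaMuSet (G : SimpleGraph V) : Set (Finset (Sym2 V) × Finset (Sym2 V)) :=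
  {p | p ∈ LambdaSet G ∧ p.1.card = muG G}

end Defs

/-- A maximum intersection triple: M a maximum matching, (H, H') ∈ Λ_μ(G),
|M ∩ (H ∪ H')| is maximized over all such choices, and subject to that,
|M ∩ H| is maximized. -/
def MaxIntersectionTriple {V : Type*} [DecidableEq V] (G : SimpleGraph V)
    (M H H' : Finset (Sym2 V)) : Prop :=
  IsMatchingSet G M ∧ M.card = nuG G ∧ (H, H') ∈ LambdaMuSet G ∧
  (∀ M₂ N₂ N₂' : Finset (Sym2 V), IsMatchingSet G M₂ → M₂.card = nuG G →
    (N₂, N₂') ∈ LambdaMuSet G →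
    (M₂ ∩ (N₂ ∪ N₂')).card ≤ (M ∩ (H ∪ H')).card) ∧
  (∀ M₂ N₂ N₂' : Finset (Sym2 V), IsMatchingSet G M₂ → M₂.card = nuG G →
    (N₂, N₂') ∈ LambdaMuSet G →
    (M₂ ∩ (N₂ ∪ N₂')).card = (M ∩ (H ∪ H')).card →
    (M₂ ∩ N₂).card ≤ (M ∩ H).card)

/-- A list of edges is A,B-alternating: its edges alternately belong to A ∖ B and
to B ∖ A (starting with either). -/
def AltEdges {V : Type*} [DecidableEq V] (A B : Finset (Sym2 V))
    (l : List (Sym2 V)) : Prop :=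
  (∀ (i : ℕ) (h : i < l.length),
    if Even i then l.get ⟨i, h⟩ ∈ A \ B else l.get ⟨i, h⟩ ∈ B \ A) ∨
  (∀ (i : ℕ) (h : i < l.length),
    if Even i then l.get ⟨i, h⟩ ∈ B \ A else l.get ⟨i, h⟩ ∈ A \ B)

/-- A maximal A,B-alternating path: an A,B-alternating path not properly contained
in a longer A,B-alternating path. -/
def IsMaxAltPath {V : Type*} [DecidableEq V] (G : SimpleGraph V)
    (A B : Finset (Sym2 V)) {u v : V} (p : G.Walk u v) : Prop :=
  p.IsPath ∧ AltEdges A B p.edges ∧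
  ¬ ∃ (u' v' : V) (q : G.Walk u' v'), q.IsPath ∧ AltEdges A B q.edges ∧
    (∀ e ∈ p.edges, e ∈ q.edges) ∧ p.edges.length < q.edges.length

lemma AltEdges.mem_sdiff_or {V : Type*} [DecidableEq V] {A B : Finset (Sym2 V)}
    {l : List (Sym2 V)} (h : AltEdges A B l) {e : Sym2 V} (he : e ∈ l) :
    e ∈ A \ B ∨ e ∈ B \ A := by
  obtain ⟨i, hi, rfl⟩ := List.mem_iff_getElem.1 he
  rcases h with h | h <;> have := h i hi <;> split_ifs at this <;> simp_all

lemma IsMatchingSet.subset {V : Type*} {G : SimpleGraph V} {A B : Finset (Sym2 V)}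
    (hB : IsMatchingSet G B) (h : A ⊆ B) : IsMatchingSet G A :=
  ⟨(Finset.coe_subset.2 h).trans hB.1, fun e he f hf => hB.2 e (h he) f (h hf)⟩

/-- A matching covers exactly twice as many vertices as it has edges. -/
lemma IsMatchingSet.card_biUnion_toFinset {V : Type*} [DecidableEq V] {G : SimpleGraph V}
    {A : Finset (Sym2 V)} (hA : IsMatchingSet G A) :
    (A.biUnion Sym2.toFinset).card = 2 * A.card := by
  rw [Finset.card_biUnion, Finset.sum_congr rfl fun e he =>
    Sym2.card_toFinset_of_not_isDiag e (G.not_isDiag_of_mem_edgeSet (hA.1 he))]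
  · simp [mul_comm]
  · intro e he f hf hne
    refine Finset.disjoint_left.2 ?_
    intro v hv hv'
    exact hA.2 e he f hf hne v (Sym2.mem_toFinset.1 hv) (Sym2.mem_toFinset.1 hv')

/-- Matchings saturating the same vertices have the same size. -/
lemma IsMatchingSet.card_eq_of_saturates_iff {V : Type*} [DecidableEq V] {G : SimpleGraph V}
    {A B : Finset (Sym2 V)} (hA : IsMatchingSet G A) (hB : IsMatchingSet G B)
    (h : ∀ v, Saturates A v ↔ Saturates B v) : A.card = B.card := by
  have key : A.biUnion Sym2.toFinset = B.biUnion Sym2.toFinset := by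
    ext v
    simpa [Saturates] using h v
  have := congrArg Finset.card key
  rw [hA.card_biUnion_toFinset, hB.card_biUnion_toFinset] at this
  omega

/-- A cycle has two distinct edges at each of its vertices. -/
lemma SimpleGraph.Walk.IsCycle.exists_edges_ne {V : Type*} {G : SimpleGraph V} {u v : V}
    {c : G.Walk u u} (hc : c.IsCycle) (hv : v ∈ c.support) :
    ∃ e ∈ c.edges, ∃ f ∈ c.edges, e ≠ f ∧ v ∈ e ∧ v ∈ f := by
  obtain ⟨x, y, hxy, hs⟩ := Set.ncard_eq_two.1 (hc.ncard_neighborSet_toSubgraph_eq_two hv)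
  have hmem : ∀ w ∈ c.toSubgraph.neighborSet v, s(v, w) ∈ c.edges := fun w hw => by
    rwa [← SimpleGraph.Walk.mem_edges_toSubgraph, SimpleGraph.Subgraph.mem_edgeSet]
  refine ⟨s(v, x), hmem x (by simp [hs]), s(v, y), hmem y (by simp [hs]), ?_, by simp, by simp⟩
  exact fun h => hxy (Sym2.congr_right.1 h)

/-- A cycle whose edges lie in the symmetric difference of two matchings has an edge of each of
them at each of its vertices. -/
lemma SimpleGraph.Walk.IsCycle.exists_mem_of_matchings {V : Type*} [DecidableEq V]
    {G : SimpleGraph V} {u : V} {c : G.Walk u u} (hc : c.IsCycle) {A B : Finset (Sym2 V)}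
    (hA : IsMatchingSet G A) (hB : IsMatchingSet G B)
    (hAB : ∀ e ∈ c.edges, e ∈ A \ B ∨ e ∈ B \ A) {g : Sym2 V} (hg : g ∈ c.edges) {v : V}
    (hv : v ∈ g) :
    (∃ e ∈ c.edges, e ∈ A ∧ v ∈ e) ∧ ∃ e ∈ c.edges, e ∈ B ∧ v ∈ e := by
  obtain ⟨e, he, f, hf, hne, hve, hvf⟩ :=
    hc.exists_edges_ne (c.mem_support_of_mem_edges hg hv)
  have hA' := fun h h' => hA.2 e h f h' hne v hve hvf
  have hB' := fun h h' => hB.2 e h f h' hne v hve hvf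
  have h₁ := hAB e he
  have h₂ := hAB f hf
  simp only [Finset.mem_sdiff] at h₁ h₂
  constructor <;> grind

/-- For a maximum intersection triple in a graph with μ(G) < ν(G), G contains no
cycle whose edges alternate between M ∖ H and H ∖ M; in particular no maximal
M,H-alternating path closes into a cycle. -/
theorem stmt12 {V : Type*} [Fintype V] [DecidableEq V] (G : SimpleGraph V)
    (hratio : muG G < nuG G) (M H H' : Finset (Sym2 V))
    (ht : MaxIntersectionTriple G M H H') :
    ¬ ∃ (u : V) (cyc : G.Walk u u), cyc.IsCycle ∧ AltEdges M H cyc.edges := by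
  rintro ⟨u, cyc, hc, halt⟩
  obtain ⟨hM, hMcard, hHH', hmax, hmax'⟩ := ht
  have hH : IsMatchingSet G H := hHH'.1.1
  have hAB : ∀ e ∈ cyc.edges, e ∈ M \ H ∨ e ∈ H \ M := fun e he => halt.mem_sdiff_or he
  set C : Finset (Sym2 V) := cyc.edges.toFinset with hC
  have hmemC : ∀ e, e ∈ C ↔ e ∈ cyc.edges := fun e => List.mem_toFinset
  have hcov : ∀ g ∈ C, ∀ v ∈ g, Saturates (M ∩ C) v ∧ Saturates (H ∩ C) v := by
    intro g hg v hv
    obtain ⟨⟨e, he, heM, hve⟩, f, hf, hfH, hvf⟩ :=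
      hc.exists_mem_of_matchings hM hH hAB ((hmemC g).1 hg) hv
    exact ⟨⟨e, Finset.mem_inter.2 ⟨heM, (hmemC e).2 he⟩, hve⟩,
      f, Finset.mem_inter.2 ⟨hfH, (hmemC f).2 hf⟩, hvf⟩
  have hcard : (M ∩ C).card = (H ∩ C).card :=
    (hM.subset Finset.inter_subset_left).card_eq_of_saturates_iff
      (hH.subset Finset.inter_subset_left) fun v =>
        ⟨fun ⟨g, hg, hv⟩ => (hcov g (Finset.mem_inter.1 hg).2 v hv).2,
          fun ⟨g, hg, hv⟩ => (hcov g (Finset.mem_inter.1 hg).2 v hv).1⟩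
  have hpos : 0 < (H ∩ C).card := by
    obtain ⟨e, he, -⟩ := hc.exists_edges_ne cyc.start_mem_support
    obtain ⟨v, hv⟩ : ∃ v, v ∈ e := ⟨_, e.out_fst_mem⟩
    obtain ⟨f, hf, -⟩ := (hcov e ((hmemC e).2 he) v hv).2
    exact Finset.card_pos.2 ⟨f, hf⟩
  have hcross : ∀ e ∈ M \ C, ∀ f ∈ H ∩ C, ∀ v ∈ e, v ∉ f := by
    intro e he f hf v hve hvf
    obtain ⟨g, hg, hvg⟩ := (hcov f (Finset.mem_inter.1 hf).2 v hvf).1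
    rw [Finset.mem_sdiff] at he
    rw [Finset.mem_inter] at hg
    exact hM.2 e he.1 g hg.1 (fun h => he.2 (h ▸ hg.2)) v hve hvg
  have hN : IsMatchingSet G (M \ C ∪ H ∩ C) := by
    refine ⟨?_, ?_⟩
    · intro e he
      rcases Finset.mem_union.1 he with he | he
      · exact hM.1 (Finset.mem_sdiff.1 he).1
      · exact hH.1 (Finset.mem_inter.1 he).1
    · intro e he f hf hne v hve hvf
      rcases Finset.mem_union.1 he with he | he <;> rcases Finset.mem_union.1 hf with hf | hf
      · exact hM.2 e (Finset.mem_sdiff.1 he).1 f (Finset.mem_sdiff.1 hf).1 hne v hve hvf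
      · exact hcross e he f hf v hve hvf
      · exact hcross f hf e he v hvf hve
      · exact hH.2 e (Finset.mem_inter.1 he).1 f (Finset.mem_inter.1 hf).1 hne v hve hvf
  have hdisj : Disjoint (M \ C) (H ∩ C) :=
    Finset.sdiff_disjoint.mono_right Finset.inter_subset_right
  have hNX : ∀ X, ((M \ C ∪ H ∩ C) ∩ X).card + (M ∩ C ∩ X).card =
      (M ∩ X).card + (H ∩ C ∩ X).card := by
    intro X
    have h₁ : M ∩ X = (M \ C) ∩ X ∪ (M ∩ C) ∩ X := by
      rw [← Finset.union_inter_distrib_right, Finset.sdiff_union_inter]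
    have h₂ : Disjoint ((M \ C) ∩ X) ((M ∩ C) ∩ X) :=
      (Finset.disjoint_sdiff_inter M C).mono Finset.inter_subset_left Finset.inter_subset_left
    rw [h₁, Finset.union_inter_distrib_right, Finset.card_union_of_disjoint h₂,
      Finset.card_union_of_disjoint
        (hdisj.mono Finset.inter_subset_left Finset.inter_subset_left)]
    omega
  have hNcard : (M \ C ∪ H ∩ C).card = nuG G := by
    have := Finset.card_sdiff_add_card_inter M C
    rw [Finset.card_union_of_disjoint hdisj]
    omega
  have hHC : ∀ X, H ⊆ X → H ∩ C ∩ X = H ∩ C := fun X hX =>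
    Finset.inter_eq_left.2 (Finset.inter_subset_left.trans hX)
  have hge : (M ∩ (H ∪ H')).card ≤ ((M \ C ∪ H ∩ C) ∩ (H ∪ H')).card := by
    have h₁ := hNX (H ∪ H')
    have h₂ : (M ∩ C ∩ (H ∪ H')).card ≤ (M ∩ C).card :=
      Finset.card_le_card Finset.inter_subset_left
    rw [hHC _ Finset.subset_union_left] at h₁
    omega
  have hle := hmax' _ H H' hN hNcard hHH' (le_antisymm (hmax _ H H' hN hNcard hHH') hge)
  have hempty : M ∩ C ∩ H = ∅ := by
    ext e
    have := hAB e
    simp only [Finset.mem_sdiff, ← hmemC] at this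
    simp only [Finset.mem_inter, Finset.notMem_empty, iff_false]
    tauto
  have h₁ := hNX H
  rw [hHC H subset_rfl, hempty, Finset.card_empty] at h₁
  omega
end

section
/- Let G be a finite simple graph with μ(G) < ν(G), let (M, H, H') be a maximum intersection triple in G, and let P be a maximal M,H-alternating path in G of length at least 2. Then P has odd length and both end edges of P belong to M. -/
open Finset

theorem card_le_nuG {V : Type*} [Fintype V] {G : SimpleGraph V} {M : Finset (Sym2 V)}
    (hM : IsMatchingSet G M) : M.card ≤ nuG G := by
  classical
  refine le_csSup ⟨Fintype.card (Sym2 V), ?_⟩ ⟨M, hM, rfl⟩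
  rintro n ⟨N, -, rfl⟩
  exact N.card_le_univ

theorem IsMatchingSet.eq_of_mem {V : Type*} {G : SimpleGraph V} {M : Finset (Sym2 V)}
    (hM : IsMatchingSet G M) {e f : Sym2 V} (he : e ∈ M) (hf : f ∈ M) {v : V}
    (hve : v ∈ e) (hvf : v ∈ f) : e = f := by
  by_contra h
  exact hM.2 e he f hf h v hve hvf

/-- No exchange of edges of `M` for at least as many edges of `H` can be possible. -/
theorem MaxIntersectionTriple.card_lt_card_of_exchange {V : Type*} [Fintype V] [DecidableEq V]
    {G : SimpleGraph V} {M H H' : Finset (Sym2 V)} (ht : MaxIntersectionTriple G M H H')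
    {X Y : Finset (Sym2 V)} (hXM : X ⊆ M) (hYH : Y ⊆ H) (hYM : Disjoint Y M)
    (hY : Y.Nonempty) (hX : ∀ e ∈ M, ∀ f ∈ Y, ∀ v, v ∈ e → v ∈ f → e ∈ X)
    (hXH : Disjoint X H) : Y.card < X.card := by
  obtain ⟨hM, hMcard, hHH, hmax, hmax'⟩ := ht
  have hH : IsMatchingSet G H := hHH.1.1
  by_contra! hXY
  have hdisj : Disjoint (M \ X) Y := hYM.symm.mono_left sdiff_subset
  have hmatch : IsMatchingSet G ((M \ X) ∪ Y) := by
    refine ⟨fun e he => ?_, fun e he f hf hef v hve hvf => ?_⟩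
    · rcases mem_union.1 (mem_coe.1 he) with h | h
      · exact hM.1 (mem_sdiff.1 h).1
      · exact hH.1 (hYH h)
    · rcases mem_union.1 he with h | h <;> rcases mem_union.1 hf with h' | h'
      · exact hef (hM.eq_of_mem (mem_sdiff.1 h).1 (mem_sdiff.1 h').1 hve hvf)
      · exact (mem_sdiff.1 h).2 (hX e (mem_sdiff.1 h).1 f h' v hve hvf)
      · exact (mem_sdiff.1 h').2 (hX f (mem_sdiff.1 h').1 e h v hvf hve)
      · exact hef (hH.eq_of_mem (hYH h) (hYH h') hve hvf)
  have hcard : ((M \ X) ∪ Y).card = M.card - X.card + Y.card := by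
    rw [card_union_of_disjoint hdisj, card_sdiff_of_subset hXM]
  have hXle := card_le_card hXM
  have hle := card_le_nuG hmatch
  have heq : ((M \ X) ∪ Y).card = nuG G := by omega
  have hinter : (M ∩ (H ∪ H')).card ≤ (((M \ X) ∪ Y) ∩ (H ∪ H')).card := by
    have hsub : ((M ∩ (H ∪ H')) \ X) ∪ Y ⊆ ((M \ X) ∪ Y) ∩ (H ∪ H') := by
      intro e he
      have := @hYH e
      simp only [mem_union, mem_inter, mem_sdiff] at he ⊢
      tauto
    have hd : Disjoint ((M ∩ (H ∪ H')) \ X) Y :=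
      hYM.symm.mono_left (sdiff_subset.trans inter_subset_left)
    have h₁ := card_le_card hsub
    rw [card_union_of_disjoint hd] at h₁
    have h₂ := le_card_sdiff X (M ∩ (H ∪ H'))
    omega
  have hH_inter : (M ∩ H).card < (((M \ X) ∪ Y) ∩ H).card := by
    have hsub : (M ∩ H) ∪ Y ⊆ ((M \ X) ∪ Y) ∩ H := by
      intro e he
      have h₁ := @hYH e
      have h₂ : e ∈ X → e ∉ H := fun h h' => disjoint_left.1 hXH h h'
      simp only [mem_union, mem_inter, mem_sdiff] at he ⊢
      tauto
    have hd : Disjoint (M ∩ H) Y := hYM.symm.mono_left inter_subset_left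
    have h₁ := card_le_card hsub
    rw [card_union_of_disjoint hd] at h₁
    have h₂ := hY.card_pos
    omega
  have h₁ := hmax _ H H' hmatch heq hHH
  have h₂ := hmax' _ H H' hmatch heq hHH (le_antisymm h₁ hinter)
  omega

theorem altEdges_iff_isChain {V : Type*} [DecidableEq V] {A B : Finset (Sym2 V)}
    {l : List (Sym2 V)} :
    AltEdges A B l ↔
      (∀ e ∈ l, e ∈ A \ B ∨ e ∈ B \ A) ∧ l.IsChain (fun e f => e ∈ A ↔ f ∉ A) := by
  rw [List.isChain_iff_getElem]
  constructor
  · intro h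
    constructor
    · intro e he
      obtain ⟨i, hi, rfl⟩ := List.mem_iff_getElem.1 he
      rcases h with h | h <;> have := h i hi <;> split_ifs at this <;> simp_all
    · intro i hi
      rcases h with h | h <;> have h₁ := h i (by omega) <;> have h₂ := h (i + 1) hi <;>
        simp only [Nat.even_add_one] at h₂ <;> split_ifs at h₁ h₂ <;> simp_all
  · rintro ⟨h, hc⟩
    rcases Nat.eq_zero_or_pos l.length with h0 | h0
    · exact Or.inl fun i hi => by omega
    have key : ∀ i (hi : i < l.length), (l[i] ∈ A ↔ (Even i ↔ l[0] ∈ A)) := by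
      intro i
      induction i with
      | zero => simp
      | succ i ih =>
        intro hi
        have h₁ := ih (by omega)
        have h₂ := hc i hi
        rw [Nat.even_add_one]
        tauto
    by_cases hA : l[0] ∈ A
    · left
      intro i hi
      have h₁ := key i hi
      have h₂ := h l[i] (List.getElem_mem hi)
      simp only [mem_sdiff, List.get_eq_getElem] at h₂ ⊢
      split_ifs <;> tauto
    · right
      intro i hi
      have h₁ := key i hi
      have h₂ := h l[i] (List.getElem_mem hi)
      simp only [mem_sdiff, List.get_eq_getElem] at h₂ ⊢
      split_ifs <;> tauto

theorem AltEdges.reverse {V : Type*} [DecidableEq V] {A B : Finset (Sym2 V)}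
    {l : List (Sym2 V)} (h : AltEdges A B l) : AltEdges A B l.reverse := by
  rw [altEdges_iff_isChain] at h ⊢
  refine ⟨fun e he => h.1 e (List.mem_reverse.1 he), List.isChain_reverse.2 ?_⟩
  exact h.2.imp fun _ _ hef => by tauto

theorem IsMaxAltPath.reverse {V : Type*} [DecidableEq V] {G : SimpleGraph V}
    {A B : Finset (Sym2 V)} {u v : V} {p : G.Walk u v} (h : IsMaxAltPath G A B p) :
    IsMaxAltPath G A B p.reverse := by
  refine ⟨h.1.reverse, ?_, ?_⟩
  · rw [SimpleGraph.Walk.edges_reverse]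
    exact h.2.1.reverse
  · rintro ⟨u', v', q, hq, hqalt, hsub, hlt⟩
    refine h.2.2 ⟨u', v', q, hq, hqalt, fun e he => hsub e ?_, ?_⟩
    · simpa using he
    · simpa using hlt

/-- If a maximal alternating path does not end in `A`, an edge of `A` at its last vertex can
only close it to an alternating cycle. -/
theorem IsMaxAltPath.mem_support_of_mem_left {V : Type*} [DecidableEq V] {G : SimpleGraph V}
    {A B : Finset (Sym2 V)} {u v w : V} {p : G.Walk u v} (h : IsMaxAltPath G A B p)
    (hvw : G.Adj v w) (hw : s(v, w) ∈ A \ B)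
    (hlast : ∀ e ∈ p.edges.getLast?, e ∉ A) : w ∈ p.support := by
  by_contra hws
  refine h.2.2 ⟨u, w, p.concat hvw, h.1.concat hws hvw, ?_, ?_, ?_⟩
  · have halt := altEdges_iff_isChain.1 h.2.1
    rw [SimpleGraph.Walk.edges_concat, List.concat_eq_append, altEdges_iff_isChain]
    constructor
    · intro e he
      rcases List.mem_append.1 he with he | he
      · exact halt.1 e he
      · rw [List.mem_singleton.1 he]
        exact Or.inl hw
    · rw [List.isChain_append]
      refine ⟨halt.2, List.isChain_singleton _, fun x hx y hy => ?_⟩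
      obtain rfl : s(v, w) = y := by simpa using hy
      have h₁ := hlast x hx
      have h₂ := (mem_sdiff.1 hw).1
      tauto
  · intro e he
    simp [he]
  · simp

theorem MaxIntersectionTriple.getLast_mem {V : Type*} [Fintype V] [DecidableEq V]
    {G : SimpleGraph V} {M H H' : Finset (Sym2 V)} (ht : MaxIntersectionTriple G M H H')
    {u v : V} {p : G.Walk u v} (hp : IsMaxAltPath G M H p) {e : Sym2 V}
    (he : p.edges.getLast? = some e) : e ∈ M := by
  by_contra heM
  have hM : IsMatchingSet G M := ht.1
  have hH : IsMatchingSet G H := ht.2.2.1.1.1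
  obtain ⟨halt, hchain⟩ := altEdges_iff_isChain.1 hp.2.1
  rw [List.isChain_iff_getElem] at hchain
  have hnodup := hp.1.isTrail.edges_nodup
  have hep : e ∈ p.edges := List.mem_of_getLast? he
  have hlen : p.edges.length = p.length := p.length_edges
  have hpos : 0 < p.edges.length := List.length_pos_of_mem hep
  have helast : p.edges[p.edges.length - 1] = e := by
    rw [List.getLast?_eq_getElem?, List.getElem?_eq_getElem (by omega)] at he
    exact Option.some.inj he
  have hmem : ∀ f ∈ p.edges, f ∉ M → f ∈ H := fun f hf hfM => by
    have := halt f hf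
    simp only [mem_sdiff] at this
    tauto
  have hmem' : ∀ f ∈ p.edges, f ∈ M → f ∉ H := fun f hf hfM => by
    have := halt f hf
    simp only [mem_sdiff] at this
    tauto
  let Y := H.filter (· ∈ p.edges)
  have hYmem : ∀ f, f ∈ Y ↔ f ∈ p.edges ∧ f ∉ M := fun f => by
    have h₁ := hmem f
    have h₂ := hmem' f
    simp only [Y, mem_filter]
    tauto
  let X := M.filter fun x => ∃ f ∈ Y, ∃ w, w ∈ x ∧ w ∈ f
  have hXH : Disjoint X H := by
    rw [disjoint_left]
    intro x hx hxH
    obtain ⟨hxM, f, hf, w, hwx, hwf⟩ := mem_filter.1 hx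
    obtain rfl := hH.eq_of_mem hxH (mem_filter.1 hf).1 hwx hwf
    exact ((hYmem _).1 hf).2 hxM
  have hlt : Y.card < X.card := by
    refine ht.card_lt_card_of_exchange (filter_subset _ _) (filter_subset _ _) ?_
      ⟨e, (hYmem e).2 ⟨hep, heM⟩⟩ ?_ hXH
    · exact disjoint_left.2 fun f hf => ((hYmem f).1 hf).2
    · exact fun x hx f hf w hwx hwf => mem_filter.2 ⟨hx, f, hf, w, hwx, hwf⟩
  -- Every edge of `X` contains the first endpoint of some edge of `Y`.
  refine absurd (card_le_card_of_forall_subsingleton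
    (fun x f => ∃ (i : ℕ) (hi : i < p.edges.length), p.edges[i] = f ∧ p.getVert i ∈ x)
    (s := X) (t := Y) ?_ ?_) (not_le.2 hlt)
  · intro x hx
    obtain ⟨hxM, f, hf, w, hwx, hwf⟩ := mem_filter.1 hx
    have goal_of : ∀ (i : ℕ) (hi : i < p.edges.length), p.edges[i] ∉ M → p.getVert i ∈ x →
        ∃ b, b ∈ Y ∧ ∃ (i : ℕ) (hi : i < p.edges.length), p.edges[i] = b ∧ p.getVert i ∈ x :=
      fun i hi h₁ h₂ => ⟨_, (hYmem _).2 ⟨List.getElem_mem hi, h₁⟩, i, hi, rfl, h₂⟩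
    obtain ⟨hfp, hfM⟩ := (hYmem f).1 hf
    obtain ⟨i, hi, rfl⟩ := List.mem_iff_getElem.1 hfp
    have hwi := hwf
    rw [SimpleGraph.Walk.getElem_edges, Sym2.mem_iff] at hwi
    rcases hwi with rfl | rfl
    · exact goal_of i hi hfM hwx
    by_cases hi1 : i + 1 < p.edges.length
    · have hnext : p.edges[i + 1] ∈ M := by
        have := hchain i hi1
        tauto
      have hxeq : x = p.edges[i + 1] := by
        refine hM.eq_of_mem hxM hnext hwx ?_
        rw [SimpleGraph.Walk.getElem_edges]
        exact Sym2.mem_mk_left _ _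
      have hi2 : i + 1 + 1 < p.edges.length := by
        by_contra hcon
        have : p.edges.length - 1 = i + 1 := by omega
        simp only [this] at helast
        exact heM (helast ▸ hnext)
      refine goal_of (i + 1 + 1) hi2 ((hchain (i + 1) hi2).1 hnext) ?_
      rw [hxeq, SimpleGraph.Walk.getElem_edges]
      exact Sym2.mem_mk_right _ _
    · have hvx : v ∈ x := by
        rwa [show i + 1 = p.length by omega, p.getVert_length] at hwx
      obtain ⟨w, rfl⟩ := hvx
      have hadj : G.Adj v w := hM.1 hxM
      have hxH : s(v, w) ∉ H := disjoint_left.1 hXH hx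
      have hw := hp.mem_support_of_mem_left hadj (mem_sdiff.2 ⟨hxM, hxH⟩) (by
        intro e' he'
        obtain rfl : e = e' := by simpa [he] using he'
        exact heM)
      obtain ⟨j, rfl, hj⟩ := SimpleGraph.Walk.mem_support_iff_exists_getVert.1 hw
      have hjlt : j < p.edges.length := by
        by_contra hcon
        rw [show j = p.length by omega, p.getVert_length] at hadj
        exact hadj.ne rfl
      by_cases hjM : p.edges[j] ∈ M
      · exfalso
        have heq : s(v, p.getVert j) = p.edges[j] := by
          refine hM.eq_of_mem hxM hjM (Sym2.mem_mk_right _ _) ?_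
          rw [SimpleGraph.Walk.getElem_edges]
          exact Sym2.mem_mk_left _ _
        rw [SimpleGraph.Walk.getElem_edges, Sym2.eq_swap, Sym2.congr_right] at heq
        have hj1 : j + 1 = p.length :=
          hp.1.getVert_injOn (show j + 1 ≤ p.length by omega) (le_refl p.length)
            (heq.symm.trans p.getVert_length.symm)
        have : p.edges.length - 1 = j := by omega
        simp only [this] at helast
        exact heM (helast ▸ hjM)
      · exact goal_of j hjlt hjM (Sym2.mem_mk_right _ _)
  · rintro f hf x ⟨hx, i, hi, hif, hix⟩ y ⟨hy, j, hj, hjf, hjy⟩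
    obtain rfl : i = j := (hnodup.getElem_inj_iff).1 (hif.trans hjf.symm)
    exact hM.eq_of_mem (mem_filter.1 hx).1 (mem_filter.1 hy).1 hix hjy

/-- For a maximum intersection triple with μ(G) < ν(G), every maximal
M,H-alternating path of length at least 2 has odd length and its end edges are in M. -/
theorem stmt13 {V : Type*} [Fintype V] [DecidableEq V] (G : SimpleGraph V)
    (hratio : muG G < nuG G) (M H H' : Finset (Sym2 V))
    (ht : MaxIntersectionTriple G M H H')
    (u v : V) (p : G.Walk u v) (hp : IsMaxAltPath G M H p)
    (hlen : 2 ≤ p.edges.length) :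
    Odd p.edges.length ∧
    ∃ e₁ e₂ : Sym2 V, p.edges.head? = some e₁ ∧ p.edges.getLast? = some e₂ ∧
      e₁ ∈ M ∧ e₂ ∈ M := by
  have hpos : 0 < p.edges.length := by omega
  have hne : p.edges ≠ [] := List.ne_nil_of_length_pos hpos
  have hlast := ht.getLast_mem hp (List.getLast?_eq_some_getLast hne)
  have hhead : p.edges.head hne ∈ M := by
    refine ht.getLast_mem hp.reverse ?_
    rw [SimpleGraph.Walk.edges_reverse, List.getLast?_reverse, List.head?_eq_some_head hne]
  refine ⟨?_, _, _, List.head?_eq_some_head hne, List.getLast?_eq_some_getLast hne, hhead, hlast⟩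
  rw [List.head_eq_getElem] at hhead
  rw [List.getLast_eq_getElem] at hlast
  by_contra hodd
  have hn : ¬ Even (p.edges.length - 1) := by
    grind
  rcases hp.2.1 with h | h
  · have := h (p.edges.length - 1) (by omega)
    rw [if_neg hn] at this
    exact (mem_sdiff.1 this).2 hlast
  · have := h 0 hpos
    rw [if_pos Even.zero] at this
    exact (mem_sdiff.1 this).2 hhead
end

section
/- Let G be a finite simple graph with μ(G) < ν(G), let (M, H, H') be a maximum intersection triple in G, and let P be a maximal M,H-alternating path in G of length at least 2. Then G contains no even cycle C such that the edges of C alternately belong to M and the remaining edges of C belong to H ∪ H', and at least one edge of C ∩ M lies on P. -/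
open Finset

section AlternatingCycle
variable {V : Type*}

lemma IsMatchingSet.eq_of_mem_s17 {G : SimpleGraph V} {M : Finset (Sym2 V)}
    (hM : IsMatchingSet G M) {x y : Sym2 V} (hx : x ∈ M) (hy : y ∈ M) {v : V}
    (hvx : v ∈ x) (hvy : v ∈ y) : x = y := by
  by_contra hne
  exact hM.2 x hx y hy hne v hvx hvy

/-- The `i`-th edge of a sequence of vertices. -/
def seqEdge (f : ℕ → V) (i : ℕ) : Sym2 V := s(f i, f (i + 1))

lemma left_mem_seqEdge (f : ℕ → V) (i : ℕ) : f i ∈ seqEdge f i := Sym2.mem_mk_left _ _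

lemma right_mem_seqEdge (f : ℕ → V) (i : ℕ) : f (i + 1) ∈ seqEdge f i := Sym2.mem_mk_right _ _

lemma seqEdge_congr {f : ℕ → V} {n : ℕ} (hf : ∀ i j, f i = f j ↔ i ≡ j [MOD n]) {i j : ℕ}
    (h : i ≡ j [MOD n]) : seqEdge f i = seqEdge f j := by
  rw [seqEdge, seqEdge, (hf i j).2 h, (hf (i + 1) (j + 1)).2 (h.add_right 1)]

lemma modEq_of_mem_seqEdge {f : ℕ → V} {m : ℕ}
    (hf : ∀ i j, f i = f j ↔ i ≡ j [MOD 2 * m]) {i j : ℕ} (hij : i % 2 = j % 2) {v : V}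
    (hi : v ∈ seqEdge f i) (hj : v ∈ seqEdge f j) : i ≡ j [MOD 2 * m] := by
  have parity : ∀ a b : ℕ, f a = f b → a % 2 = b % 2 := fun a b h =>
    ((hf a b).1 h).of_mul_right m
  rw [seqEdge, Sym2.mem_iff] at hi hj
  rcases hi with rfl | rfl <;> rcases hj with h | h
  · exact (hf _ _).1 h
  · have := parity _ _ h
    omega
  · have := parity _ _ h
    omega
  · exact Nat.ModEq.add_right_cancel' 1 ((hf _ _).1 h)

lemma seqEdge_succ_ne {f : ℕ → V} {m : ℕ} (hm : 2 ≤ m)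
    (hf : ∀ i j, f i = f j ↔ i ≡ j [MOD 2 * m]) (i : ℕ) : seqEdge f i ≠ seqEdge f (i + 1) := by
  intro h
  have hmem := left_mem_seqEdge f i
  rw [h, seqEdge, Sym2.mem_iff] at hmem
  rcases hmem with h | h
  · have := (Nat.modEq_iff_dvd' (by omega)).1 ((hf _ _).1 h)
    have := Nat.le_of_dvd (by omega) this
    omega
  · have := (Nat.modEq_iff_dvd' (by omega)).1 ((hf _ _).1 h)
    have := Nat.le_of_dvd (by omega) this
    omega

/-- The vertices of a cycle, read periodically, identify exactly the indices congruent modulo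
its length. -/
lemma SimpleGraph.Walk.IsCycle.getVert_mod_eq_iff {G : SimpleGraph V} {w : V} {c : G.Walk w w}
    (hc : c.IsCycle) (i j : ℕ) :
    c.getVert (i % c.length) = c.getVert (j % c.length) ↔ i ≡ j [MOD c.length] := by
  have h3 := hc.three_le_length
  refine ⟨fun h => ?_, fun h => congrArg c.getVert h⟩
  have hi := Nat.mod_lt i (by omega : c.length > 0)
  have hj := Nat.mod_lt j (by omega : c.length > 0)
  exact hc.getVert_injOn' (by simp only [Set.mem_ofPred_eq]; omega)
    (by simp only [Set.mem_ofPred_eq]; omega) h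

lemma SimpleGraph.Walk.edges_get_eq {G : SimpleGraph V} {a b : V} (c : G.Walk a b) (i : ℕ)
    (h : i < c.edges.length) : c.edges.get ⟨i, h⟩ = s(c.getVert i, c.getVert (i + 1)) := by
  induction c generalizing i with
  | nil => simp at h
  | cons hadj c ih =>
    cases i with
    | zero => simp
    | succ i =>
      simpa using ih i (by simpa using h)

lemma SimpleGraph.Walk.seqEdge_getVert_mod {G : SimpleGraph V} {w : V} (c : G.Walk w w)
    (hc : 0 < c.length) (i : ℕ) :
    seqEdge (fun i => c.getVert (i % c.length)) i =
      c.edges.get ⟨i % c.length, by rw [c.length_edges]; exact Nat.mod_lt _ hc⟩ := by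
  rw [c.edges_get_eq, seqEdge]
  have hlt := Nat.mod_lt i hc
  rcases eq_or_ne (i % c.length + 1) c.length with h | h
  · have h' : (i + 1) % c.length = 0 := by
      rw [← Nat.mod_add_mod, h, Nat.mod_self]
    simp [h, h']
  · rw [← Nat.mod_add_mod, Nat.mod_eq_of_lt (show i % c.length + 1 < c.length by omega)]

variable [DecidableEq V]

/-- The edges of a closed vertex sequence of length `2 * m` whose index has the parity of `c`. -/
def paritySeqEdges (f : ℕ → V) (m c : ℕ) : Finset (Sym2 V) :=
  (range m).image fun k => seqEdge f (2 * k + c)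

lemma card_paritySeqEdges {f : ℕ → V} {m : ℕ}
    (hf : ∀ i j, f i = f j ↔ i ≡ j [MOD 2 * m]) (c : ℕ) : (paritySeqEdges f m c).card = m := by
  rw [paritySeqEdges, card_image_of_injOn, card_range]
  intro a ha b hb hab
  simp only [coe_range, Set.mem_Iio] at ha hb
  have hmem := left_mem_seqEdge f (2 * a + c)
  have hmem' : f (2 * a + c) ∈ seqEdge f (2 * b + c) := by
    rwa [show seqEdge f (2 * a + c) = seqEdge f (2 * b + c) from hab] at hmem
  have h : 2 * a + c ≡ 2 * b + c [MOD 2 * m] :=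
    modEq_of_mem_seqEdge hf (by omega) (left_mem_seqEdge f _) hmem'
  have h' : 2 * a ≡ 2 * b [MOD 2 * m] := Nat.ModEq.add_right_cancel' c h
  have := h'.eq_of_lt_of_lt (by omega) (by omega)
  omega

lemma mem_paritySeqEdges {f : ℕ → V} {m : ℕ} (hm : 0 < m)
    (hf : ∀ i j, f i = f j ↔ i ≡ j [MOD 2 * m]) (k c : ℕ) :
    seqEdge f (2 * k + c) ∈ paritySeqEdges f m c := by
  refine mem_image.2 ⟨k % m, mem_range.2 (Nat.mod_lt _ hm), seqEdge_congr hf ?_⟩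
  exact ((Nat.mod_modEq k m).mul_left' 2).add_right c

lemma card_exchange_inter {M A B : Finset (Sym2 V)} (hA : A ⊆ M) (hB : Disjoint B M)
    (S : Finset (Sym2 V)) :
    ((M \ A ∪ B) ∩ S).card + (A ∩ S).card = (M ∩ S).card + (B ∩ S).card := by
  have h1 : (M \ A ∪ B) ∩ S = (M ∩ S) \ (A ∩ S) ∪ (B ∩ S) := by
    ext x
    simp only [mem_inter, mem_union, mem_sdiff]
    tauto
  have h2 : Disjoint ((M ∩ S) \ (A ∩ S)) (B ∩ S) :=
    (hB.mono inter_subset_left (sdiff_subset.trans inter_subset_left)).symm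
  rw [h1, card_union_of_disjoint h2]
  have := card_sdiff_add_card_eq_card (inter_subset_inter_right hA : A ∩ S ⊆ M ∩ S)
  omega

lemma IsMatchingSet.exchange {G : SimpleGraph V} {M A B : Finset (Sym2 V)}
    (hM : IsMatchingSet G M) (hB : IsMatchingSet G B) (hA : A ⊆ M)
    (hcov : ∀ x ∈ B, ∀ v ∈ x, ∃ a ∈ A, v ∈ a) : IsMatchingSet G (M \ A ∪ B) := by
  have key : ∀ x ∈ M \ A, ∀ y ∈ B, ∀ v ∈ x, v ∉ y := by
    intro x hx y hy v hvx hvy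
    obtain ⟨a, ha, hva⟩ := hcov y hy v hvy
    obtain ⟨hxM, hxA⟩ := mem_sdiff.1 hx
    exact hxA (hM.eq_of_mem_s17 hxM (hA ha) hvx hva ▸ ha)
  refine ⟨?_, ?_⟩
  · intro x hx
    rcases mem_union.1 hx with h | h
    · exact hM.1 (mem_sdiff.1 h).1
    · exact hB.1 h
  · intro x hx y hy hne v hvx hvy
    rcases mem_union.1 hx with h | h <;> rcases mem_union.1 hy with h' | h'
    · exact hM.2 x (mem_sdiff.1 h).1 y (mem_sdiff.1 h').1 hne v hvx hvy
    · exact key x h y h' v hvx hvy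
    · exact key y h' x h v hvy hvx
    · exact hB.2 x h y h' hne v hvx hvy

/-- On a cycle alternating between `M` and `H ∪ H'`, a maximum intersection triple has all its
`M`-edges in `H`. -/
lemma MaxIntersectionTriple.seqEdge_mem {G : SimpleGraph V} {M H H' : Finset (Sym2 V)}
    (ht : MaxIntersectionTriple G M H H') {f : ℕ → V} {m : ℕ} (hm : 2 ≤ m)
    (hf : ∀ i j, f i = f j ↔ i ≡ j [MOD 2 * m])
    (hMe : ∀ k, seqEdge f (2 * k) ∈ M) (hHe : ∀ k, seqEdge f (2 * k + 1) ∈ H ∪ H') (k₀ : ℕ) :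
    seqEdge f (2 * k₀) ∈ H := by
  obtain ⟨hM, hcard, hΛ, hmax₁, hmax₂⟩ := ht
  obtain ⟨⟨hHm, hHm', hdisj, -⟩, -⟩ := id hΛ
  dsimp only at hHm hHm' hdisj
  set A := paritySeqEdges f m 0
  set B := paritySeqEdges f m 1
  have hcA : A.card = m := card_paritySeqEdges hf 0
  have hcB : B.card = m := card_paritySeqEdges hf 1
  have hmA : ∀ k, seqEdge f (2 * k) ∈ A := fun k => mem_paritySeqEdges (by omega) hf k 0
  have hmB : ∀ k, seqEdge f (2 * k + 1) ∈ B := fun k => mem_paritySeqEdges (by omega) hf k 1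
  have hAex : ∀ x ∈ A, ∃ k, seqEdge f (2 * k) = x := fun x hx => by
    obtain ⟨k, -, rfl⟩ := mem_image.1 hx
    exact ⟨k, rfl⟩
  have hBex : ∀ x ∈ B, ∃ k, seqEdge f (2 * k + 1) = x := fun x hx => by
    obtain ⟨k, -, rfl⟩ := mem_image.1 hx
    exact ⟨k, rfl⟩
  have hAM : A ⊆ M := fun x hx => by
    obtain ⟨k, rfl⟩ := hAex x hx
    exact hMe k
  have hBH : B ⊆ H ∪ H' := fun x hx => by
    obtain ⟨k, rfl⟩ := hBex x hx
    exact hHe k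
  have hadj : ∀ {N : Finset (Sym2 V)}, IsMatchingSet G N → ∀ i,
      seqEdge f i ∈ N → seqEdge f (i + 1) ∉ N := fun hN i h h' =>
    seqEdge_succ_ne hm hf i
      (hN.eq_of_mem_s17 h h' (right_mem_seqEdge f i) (left_mem_seqEdge f (i + 1)))
  have hBM : Disjoint B M := Finset.disjoint_left.2 fun x hx hxM => by
    obtain ⟨k, rfl⟩ := hBex x hx
    exact hadj hM (2 * k) (hMe k) hxM
  have hBmatch : IsMatchingSet G B := by
    refine ⟨fun x hx => ?_, fun x hx y hy hne v hvx hvy => ?_⟩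
    · rcases mem_union.1 (hBH hx) with h | h
      · exact hHm.1 h
      · exact hHm'.1 h
    · obtain ⟨k, rfl⟩ := hBex x hx
      obtain ⟨l, rfl⟩ := hBex y hy
      exact hne (seqEdge_congr hf (modEq_of_mem_seqEdge hf (by omega) hvx hvy))
  have hcov : ∀ x ∈ B, ∀ v ∈ x, ∃ a ∈ A, v ∈ a := by
    intro x hx v hv
    obtain ⟨k, rfl⟩ := hBex x hx
    rcases Sym2.mem_iff.1 hv with rfl | rfl
    · exact ⟨_, hmA k, right_mem_seqEdge f (2 * k)⟩
    · exact ⟨_, hmA (k + 1), left_mem_seqEdge f (2 * (k + 1))⟩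
  have hM' : IsMatchingSet G (M \ A ∪ B) := hM.exchange hBmatch hAM hcov
  have hcM' : (M \ A ∪ B).card = nuG G := by
    have h := card_exchange_inter hAM hBM (M \ A ∪ B ∪ M)
    have hAB : A ⊆ M \ A ∪ B ∪ M := hAM.trans subset_union_right
    rw [inter_eq_left.2 subset_union_left, inter_eq_left.2 hAB,
      inter_eq_left.2 (subset_union_right : M ⊆ _),
      inter_eq_left.2 ((subset_union_right : B ⊆ M \ A ∪ B).trans subset_union_left)] at h
    omega
  have hU := card_exchange_inter hAM hBM (H ∪ H')
  rw [inter_eq_left.2 hBH] at hU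
  have hle := hmax₁ _ H H' hM' hcM' hΛ
  have hAH : A ⊆ H ∪ H' := by
    have h : A ∩ (H ∪ H') = A := eq_of_subset_of_card_le inter_subset_left (by omega)
    exact inter_eq_left.1 h
  rw [inter_eq_left.2 hAH] at hU
  have hle' := hmax₂ _ H H' hM' hcM' hΛ (by omega)
  by_contra hk₀
  have hall : ∀ i, seqEdge f i ∈ H ∪ H' := fun i => by
    obtain ⟨k, rfl | rfl⟩ := Nat.even_or_odd' i
    · exact hAH (hmA k)
    · exact hHe k
  have hstep : ∀ i, seqEdge f (i + 1) ∈ H ↔ seqEdge f i ∉ H := fun i => by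
    refine ⟨fun h h' => hadj hHm i h' h, fun h => ?_⟩
    have h₀ := (mem_union.1 (hall i)).resolve_left h
    exact (mem_union.1 (hall (i + 1))).resolve_right (hadj hHm' i h₀)
  have hprop : ∀ j, seqEdge f (2 * k₀ + 2 * j) ∉ H := fun j => by
    induction j with
    | zero => exact hk₀
    | succ j ih =>
      intro h
      exact (hstep (2 * k₀ + 2 * j + 1)).1 h ((hstep _).2 ih)
  have heven : ∀ k, seqEdge f (2 * k) ∉ H := fun k => by
    have h := hprop (k + (m - 1) * k₀)
    rwa [seqEdge_congr hf (j := 2 * k)] at h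
    obtain ⟨d, rfl⟩ : ∃ d, m = d + 1 := ⟨m - 1, by omega⟩
    have : 2 * k₀ + 2 * (k + (d + 1 - 1) * k₀) = 2 * k + 2 * (d + 1) * k₀ := by
      rw [Nat.add_sub_cancel]
      ring
    rw [this]
    simp [Nat.ModEq]
  have hH := card_exchange_inter hAM hBM H
  have hAH0 : A ∩ H = ∅ := eq_empty_of_forall_notMem fun x hx => by
    obtain ⟨k, rfl⟩ := hAex x (mem_inter.1 hx).1
    exact heven k (mem_inter.1 hx).2
  have hBHH : B ∩ H = B := inter_eq_left.2 fun x hx => by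
    obtain ⟨k, rfl⟩ := hBex x hx
    exact (hstep _).2 (heven k)
  rw [hAH0, hBHH, card_empty] at hH
  omega

end AlternatingCycle

/-- For a maximum intersection triple with μ(G) < ν(G) and a maximal
M,H-alternating path P of length at least 2: there is no even cycle whose edges
alternately belong to M, the remaining edges belonging to H ∪ H', with at least
one of its M-edges lying on P. -/
theorem stmt17 {V : Type*} [Fintype V] [DecidableEq V] (G : SimpleGraph V)
    (hratio : muG G < nuG G) (M H H' : Finset (Sym2 V))
    (ht : MaxIntersectionTriple G M H H')
    (u v : V) (p : G.Walk u v) (hp : IsMaxAltPath G M H p)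
    (hlen : 2 ≤ p.edges.length) :
    ¬ ∃ (w : V) (cyc : G.Walk w w), cyc.IsCycle ∧ Even cyc.edges.length ∧
      ((∀ (i : ℕ) (h : i < cyc.edges.length),
          if Even i then cyc.edges.get ⟨i, h⟩ ∈ M
          else cyc.edges.get ⟨i, h⟩ ∈ H ∪ H') ∨
       (∀ (i : ℕ) (h : i < cyc.edges.length),
          if Even i then cyc.edges.get ⟨i, h⟩ ∈ H ∪ H'
          else cyc.edges.get ⟨i, h⟩ ∈ M)) ∧
      (∃ e ∈ cyc.edges, e ∈ M ∧ e ∈ p.edges) := by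
  rintro ⟨w, c, hc, heven, halt, e, hec, heM, hep⟩
  have heH : e ∉ H := by
    obtain ⟨i, hi⟩ := List.get_of_mem hep
    rcases hp.2.1 with h | h <;> have h := h i i.2 <;>
      change (if Even (i : ℕ) then p.edges.get i ∈ _ else p.edges.get i ∈ _) at h <;>
      rw [hi] at h <;> split_ifs at h
    · exact (mem_sdiff.1 h).2
    · exact absurd heM (mem_sdiff.1 h).2
    · exact absurd heM (mem_sdiff.1 h).2
    · exact (mem_sdiff.1 h).2
  rw [c.length_edges] at heven
  have h3 := hc.three_le_length
  obtain ⟨m, hm⟩ := heven.exists_two_nsmul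
  rw [smul_eq_mul] at hm
  have hf := hc.getVert_mod_eq_iff
  have hedge := c.seqEdge_getVert_mod (by omega)
  set f : ℕ → V := fun i => c.getVert (i % c.length) with hfdef
  replace hf : ∀ i j, f i = f j ↔ i ≡ j [MOD 2 * m] := hm ▸ hf
  have hpar : ∀ i, Even (i % c.length) ↔ Even i := fun i => by
    rw [hm, Nat.even_iff, Nat.even_iff, Nat.mod_mul_right_mod]
  obtain ⟨⟨i, hi⟩, hie⟩ := List.get_of_mem hec
  have hei : seqEdge f i = e := by
    rw [hedge, ← hie]
    congr 2
    exact Nat.mod_eq_of_lt (c.length_edges ▸ hi)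
  have hM := ht.1
  rcases halt with halt | halt
  · have hMe : ∀ k, seqEdge f (2 * k) ∈ M := fun k => by
      rw [hedge]
      have := halt (2 * k % c.length) (by rw [c.length_edges]; exact Nat.mod_lt _ (by omega))
      rwa [if_pos ((hpar _).2 (even_two_mul k))] at this
    have hHe : ∀ k, seqEdge f (2 * k + 1) ∈ H ∪ H' := fun k => by
      rw [hedge]
      have := halt ((2 * k + 1) % c.length) (by rw [c.length_edges]; exact Nat.mod_lt _ (by omega))
      rwa [if_neg (by rw [hpar]; exact Nat.not_even_two_mul_add_one k)] at this
    obtain ⟨k, rfl | rfl⟩ := Nat.even_or_odd' i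
    · exact heH (hei ▸ ht.seqEdge_mem (by omega) hf hMe hHe k)
    · exact seqEdge_succ_ne (by omega) hf (2 * k) (hM.eq_of_mem_s17 (hMe k) (hei ▸ heM)
        (right_mem_seqEdge f _) (left_mem_seqEdge f _))
  · have hMe : ∀ k, seqEdge f (2 * k + 1) ∈ M := fun k => by
      rw [hedge]
      have := halt ((2 * k + 1) % c.length) (by rw [c.length_edges]; exact Nat.mod_lt _ (by omega))
      rwa [if_neg (by rw [hpar]; exact Nat.not_even_two_mul_add_one k)] at this
    have hHe : ∀ k, seqEdge f (2 * k) ∈ H ∪ H' := fun k => by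
      rw [hedge]
      have := halt (2 * k % c.length) (by rw [c.length_edges]; exact Nat.mod_lt _ (by omega))
      rwa [if_pos ((hpar _).2 (even_two_mul k))] at this
    obtain ⟨k, rfl | rfl⟩ := Nat.even_or_odd' i
    · exact seqEdge_succ_ne (by omega) hf (2 * k) (hM.eq_of_mem_s17 (hei ▸ heM) (hMe k)
        (right_mem_seqEdge f _) (left_mem_seqEdge f _))
    · have hf' : ∀ i j, f (i + 1) = f (j + 1) ↔ i ≡ j [MOD 2 * m] := fun i j =>
        (hf _ _).trans ⟨Nat.ModEq.add_right_cancel' 1, Nat.ModEq.add_right 1⟩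
      exact heH (hei ▸ ht.seqEdge_mem (f := fun i => f (i + 1)) (by omega) hf' hMe
        (fun k => hHe (k + 1)) k)
end

section
/- There exists a finite connected simple graph G with an odd number of vertices such that μ(G) = 5 and ν(G) = 6; in particular, there exists a connected graph with μ(G)/ν(G) = 5/6 < 1 that does not admit a perfect matching. -/
open Finset

/-- The edges of a tree on 13 vertices: two adjacent vertices `0` and `1`, each carrying two pendant
paths of length two, together with a path `11, 2, 12` whose midpoint is joined to `0`. -/
def spiderEdges : Finset (Sym2 (Fin 13)) :=
  {s(0, 1), s(0, 2), s(0, 3), s(3, 4), s(0, 5), s(5, 6), s(1, 7), s(7, 8), s(1, 9), s(9, 10),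
    s(2, 11), s(2, 12)}

/-- The tree with edge set `spiderEdges`. -/
def spider : SimpleGraph (Fin 13) :=
  SimpleGraph.fromEdgeSet ↑spiderEdges

lemma spider_adj {a b : Fin 13} : spider.Adj a b ↔ s(a, b) ∈ spiderEdges ∧ a ≠ b := by
  simp [spider]

lemma edgeSet_spider : spider.edgeSet = ↑spiderEdges := by
  ext e
  rw [spider, SimpleGraph.edgeSet_fromEdgeSet, Set.mem_sdiff, and_iff_left_iff_imp]
  exact (by decide : ∀ e ∈ spiderEdges, ¬ e.IsDiag) e

lemma spider_connected : spider.Connected := by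
  have adj : ∀ a b : Fin 13, s(a, b) ∈ spiderEdges → a ≠ b → spider.Reachable a b :=
    fun a b h hab => (spider_adj.2 ⟨h, hab⟩).reachable
  have h1 := adj 0 1 (by decide) (by decide)
  have h2 := adj 0 2 (by decide) (by decide)
  have h3 := adj 0 3 (by decide) (by decide)
  have h5 := adj 0 5 (by decide) (by decide)
  have h7 := h1.trans (adj 1 7 (by decide) (by decide))
  have h9 := h1.trans (adj 1 9 (by decide) (by decide))
  have root : ∀ v, spider.Reachable 0 v := by
    intro v
    fin_cases v
    · exact .rfl
    · exact h1
    · exact h2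
    · exact h3
    · exact h3.trans (adj 3 4 (by decide) (by decide))
    · exact h5
    · exact h5.trans (adj 5 6 (by decide) (by decide))
    · exact h7
    · exact h7.trans (adj 7 8 (by decide) (by decide))
    · exact h9
    · exact h9.trans (adj 9 10 (by decide) (by decide))
    · exact h2.trans (adj 2 11 (by decide) (by decide))
    · exact h2.trans (adj 2 12 (by decide) (by decide))
  exact ⟨fun a b => (root a).symm.trans (root b)⟩

lemma isMatchingSet_spider_iff {M : Finset (Sym2 (Fin 13))} :
    IsMatchingSet spider M ↔
      M ⊆ spiderEdges ∧ ∀ e ∈ M, ∀ f ∈ M, e ≠ f → ∀ v, v ∈ e → v ∉ f := by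
  rw [IsMatchingSet, edgeSet_spider, Finset.coe_subset]

/-- The number of times (zero or one) that `e` occurs in `M`. -/
def edgeCount (M : Finset (Sym2 (Fin 13))) (e : Sym2 (Fin 13)) : ℕ :=
  if e ∈ M then 1 else 0

lemma card_eq_sum_edgeCount {M : Finset (Sym2 (Fin 13))} (hM : M ⊆ spiderEdges) :
    M.card = ∑ e ∈ spiderEdges, edgeCount M e := by
  simp only [edgeCount]
  rw [Finset.sum_ite_mem, Finset.inter_eq_right.2 hM, Finset.card_eq_sum_ones]

lemma card_eq_add_edgeCount {M : Finset (Sym2 (Fin 13))} (hM : M ⊆ spiderEdges) :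
    M.card = edgeCount M s(0, 1) + edgeCount M s(0, 2) + edgeCount M s(0, 3) +
      edgeCount M s(3, 4) + edgeCount M s(0, 5) + edgeCount M s(5, 6) + edgeCount M s(1, 7) +
      edgeCount M s(7, 8) + edgeCount M s(1, 9) + edgeCount M s(9, 10) + edgeCount M s(2, 11) +
      edgeCount M s(2, 12) := by
  rw [card_eq_sum_edgeCount hM, spiderEdges]
  repeat rw [Finset.sum_insert (by decide)]
  rw [Finset.sum_singleton]
  ring

lemma edgeCount_add_le {M : Finset (Sym2 (Fin 13))} (hM : IsMatchingSet spider M)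
    (v a b : Fin 13) (hab : a ≠ b) : edgeCount M s(v, a) + edgeCount M s(v, b) ≤ 1 := by
  have h : ¬ (s(v, a) ∈ M ∧ s(v, b) ∈ M) := fun ⟨ha, hb⟩ =>
    hM.2 _ ha _ hb (fun h => hab (Sym2.congr_right.1 h)) v (Sym2.mem_mk_left v a) (Sym2.mem_mk_left v b)
  unfold edgeCount
  split_ifs <;> first | omega | exact absurd ⟨‹_›, ‹_›⟩ h

lemma edgeCount_add_edgeCount_le {H H' : Finset (Sym2 (Fin 13))} (h : Disjoint H H')
    (e : Sym2 (Fin 13)) : edgeCount H e + edgeCount H' e ≤ 1 := by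
  have h : ¬ (e ∈ H ∧ e ∈ H') := fun ⟨he, he'⟩ => Finset.disjoint_left.1 h he he'
  unfold edgeCount
  split_ifs <;> first | omega | exact absurd ⟨‹_›, ‹_›⟩ h

/-- The matching inequalities at the vertices of `spider`. -/
lemma spider_vertex_bounds {M : Finset (Sym2 (Fin 13))} (hM : IsMatchingSet spider M) :
    edgeCount M s(0, 1) + edgeCount M s(0, 2) + edgeCount M s(0, 3) + edgeCount M s(0, 5) ≤ 1 ∧
    edgeCount M s(0, 1) + edgeCount M s(1, 7) + edgeCount M s(1, 9) ≤ 1 ∧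
    edgeCount M s(0, 2) + edgeCount M s(2, 11) + edgeCount M s(2, 12) ≤ 1 ∧
    edgeCount M s(0, 3) + edgeCount M s(3, 4) ≤ 1 ∧
    edgeCount M s(0, 5) + edgeCount M s(5, 6) ≤ 1 ∧
    edgeCount M s(1, 7) + edgeCount M s(7, 8) ≤ 1 ∧
    edgeCount M s(1, 9) + edgeCount M s(9, 10) ≤ 1 := by
  have key := edgeCount_add_le hM
  have swap : ∀ a b : Fin 13, edgeCount M s(a, b) = edgeCount M s(b, a) := fun a b => by
    rw [Sym2.eq_swap]
  have h12 := key 0 1 2 (by decide)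
  have h13 := key 0 1 3 (by decide)
  have h15 := key 0 1 5 (by decide)
  have h23 := key 0 2 3 (by decide)
  have h25 := key 0 2 5 (by decide)
  have h35 := key 0 3 5 (by decide)
  have k07 := key 1 0 7 (by decide)
  have k09 := key 1 0 9 (by decide)
  have k79 := key 1 7 9 (by decide)
  have lx := key 2 0 11 (by decide)
  have lz := key 2 0 12 (by decide)
  have lxz := key 2 11 12 (by decide)
  have m3 := key 3 0 4 (by decide)
  have m5 := key 5 0 6 (by decide)
  have m7 := key 7 1 8 (by decide)
  have m9 := key 9 1 10 (by decide)
  rw [swap 1 0] at k07 k09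
  rw [swap 2 0] at lx lz
  rw [swap 3 0] at m3
  rw [swap 5 0] at m5
  rw [swap 7 1] at m7
  rw [swap 9 1] at m9
  omega

lemma spider_card_le {M : Finset (Sym2 (Fin 13))} (hM : IsMatchingSet spider M) :
    M.card ≤ 6 := by
  have hc := card_eq_add_edgeCount (isMatchingSet_spider_iff.1 hM).1
  have hv := spider_vertex_bounds hM
  omega

/-- Two disjoint matchings of `spider` have at most ten edges in total, and when they have exactly
ten, the first of them has at most five. -/
lemma spider_disjoint_bounds {H H' : Finset (Sym2 (Fin 13))} (hH : IsMatchingSet spider H)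
    (hH' : IsMatchingSet spider H') (hd : Disjoint H H') :
    H.card + H'.card ≤ 10 ∧ (H.card + H'.card = 10 → H.card ≤ 5) := by
  have hc := card_eq_add_edgeCount (isMatchingSet_spider_iff.1 hH).1
  have hc' := card_eq_add_edgeCount (isMatchingSet_spider_iff.1 hH').1
  have hv := spider_vertex_bounds hH
  have hv' := spider_vertex_bounds hH'
  have d34 := edgeCount_add_edgeCount_le hd s(3, 4)
  have d56 := edgeCount_add_edgeCount_le hd s(5, 6)
  have d78 := edgeCount_add_edgeCount_le hd s(7, 8)
  have d90 := edgeCount_add_edgeCount_le hd s(9, 10)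
  constructor
  · omega
  · intro h
    omega

/-- One of two disjoint matchings of `spider` covering all edges except `s(0, 1)` and `s(0, 2)`. -/
def spiderLeft : Finset (Sym2 (Fin 13)) :=
  {s(3, 4), s(0, 5), s(7, 8), s(1, 9), s(2, 11)}

/-- The matching of `spider` complementary to `spiderLeft`. -/
def spiderRight : Finset (Sym2 (Fin 13)) :=
  {s(0, 3), s(5, 6), s(1, 7), s(9, 10), s(2, 12)}

set_option maxRecDepth 4000 in
lemma isMatchingSet_spiderLeft : IsMatchingSet spider spiderLeft :=
  isMatchingSet_spider_iff.2 ⟨by decide, by decide⟩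

set_option maxRecDepth 4000 in
lemma isMatchingSet_spiderRight : IsMatchingSet spider spiderRight :=
  isMatchingSet_spider_iff.2 ⟨by decide, by decide⟩

lemma disjoint_spiderLeft_spiderRight : Disjoint spiderLeft spiderRight := by
  decide

lemma lamG_spider : lamG spider = 10 := by
  refine IsGreatest.csSup_eq ⟨⟨spiderLeft, spiderRight, isMatchingSet_spiderLeft,
    isMatchingSet_spiderRight, disjoint_spiderLeft_spiderRight, by decide⟩, ?_⟩
  rintro n ⟨H, H', hH, hH', hd, rfl⟩
  exact (spider_disjoint_bounds hH hH' hd).1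

lemma muG_spider : muG spider = 5 := by
  refine IsGreatest.csSup_eq ⟨⟨(spiderLeft, spiderRight), ⟨isMatchingSet_spiderLeft,
    isMatchingSet_spiderRight, disjoint_spiderLeft_spiderRight, ?_⟩, by decide⟩, ?_⟩
  · rw [lamG_spider]
    decide
  · rintro n ⟨p, ⟨hH, hH', hd, hc⟩, rfl⟩
    exact (spider_disjoint_bounds hH hH' hd).2 (hc.trans lamG_spider)

set_option maxRecDepth 4000 in
lemma nuG_spider : nuG spider = 6 := by
  refine IsGreatest.csSup_eq ⟨⟨{s(0, 1), s(3, 4), s(5, 6), s(7, 8), s(9, 10), s(2, 11)},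
    isMatchingSet_spider_iff.2 ⟨by decide, by decide⟩, by decide⟩, ?_⟩
  rintro n ⟨M, hM, rfl⟩
  exact spider_card_le hM

lemma not_exists_perfect_spider :
    ¬ ∃ M : Finset (Sym2 (Fin 13)), IsMatchingSet spider M ∧ ∀ v, Saturates M v := by
  rintro ⟨M, hM, hsat⟩
  have hsub := (isMatchingSet_spider_iff.1 hM).1
  obtain ⟨e, he, hve⟩ := hsat 11
  obtain ⟨f, hf, hvf⟩ := hsat 12
  obtain rfl := (by decide : ∀ e ∈ spiderEdges, 11 ∈ e → e = s(2, 11)) e (hsub he) hve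
  obtain rfl := (by decide : ∀ e ∈ spiderEdges, 12 ∈ e → e = s(2, 12)) f (hsub hf) hvf
  exact hM.2 _ he _ hf (by decide) 2 (by decide) (by decide)

/-- There is a finite connected graph with an odd number of vertices such that
μ(G) = 5 and ν(G) = 6; in particular a connected graph with μ/ν = 5/6 < 1 and
no perfect matching. -/
theorem stmt18 :
    ∃ (V : Type) (_ : Fintype V) (G : SimpleGraph V),
      G.Connected ∧ Odd (Fintype.card V) ∧ muG G = 5 ∧ nuG G = 6 ∧
      ¬ ∃ M : Finset (Sym2 V), IsMatchingSet G M ∧ ∀ v : V, Saturates M v := by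
  exact ⟨Fin 13, inferInstance, spider, spider_connected, by decide, muG_spider, nuG_spider,
    not_exists_perfect_spider⟩
end
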